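/- Let Γ be a finitely generated free abelian group and α: Γ → ℂ* a group homomorphism (character). If α is non-trivial, then the group cohomology H^n(Γ, ℂ_α) vanishes for all n ≥ 0, where ℂ_α denotes ℂ with the Γ-action given by multiplication by α. -/

import Mathlib

open CategoryTheory

/-- The one-dimensional complex representation `ℂ_α` of a group `G` given by a
character `α : G →* ℂˣ`: `g` acts on `z ∈ ℂ` by multiplication by `α g`. -/
noncomputable def charRep (G : Type) [Group G] (α : G →* ℂˣ) : Rep ℂ G :=
  Rep.of
    { toFun := fun g => (α g : ℂ) • (LinearMap.id : ℂ →ₗ[ℂ] ℂ)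
      map_one' := by
        ext x
        simp
      map_mul' := fun g h => by
        ext x
        simp [mul_smul, mul_comm] }

/-- If an element `g` of a commutative group `G` acts on `A` so that `ρ(g) - 1` is invertible, then the
cohomology of `G` with coefficients in `A` vanishes. -/
theorem groupCohomology.isZero_of_isIso_applyAsHom_sub_id.{u} {k G : Type u} [CommRing k] [CommGroup G]
    (A : Rep.{u} k G) (g : G) [IsIso (A.applyAsHom g - 𝟙 A)] (n : ℕ) :
    Limits.IsZero (groupCohomology A n) := by
  let P := Rep.barResolution k G
  let T : P.complex ⟶ P.complex :=
    { f := fun i => (P.complex.X i).applyAsHom g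
      comm' := fun i j _ => Rep.applyAsHom_comm _ g }
  have hT : T ≫ P.π = P.π := by
    apply HomologicalComplex.to_single_hom_ext
    have h1 : (Rep.trivial k G k).applyAsHom g = 𝟙 _ := rfl
    have h2 : (((ChainComplex.single₀ (Rep k G)).obj (Rep.trivial k G k)).X 0).applyAsHom g
        = 𝟙 _ := by
      let e := HomologicalComplex.singleObjXSelf (ComplexShape.down ℕ) 0 (Rep.trivial k G k)
      rw [← cancel_mono e.hom]
      exact (Rep.applyAsHom_comm e.hom g).trans (by rw [h1, Category.comp_id, Category.id_comp])
    exact (Rep.applyAsHom_comm (P.π.f 0) g).trans (by rw [h2, Category.comp_id])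
  let s : Homotopy T (𝟙 _) := ProjectiveResolution.liftHomotopy (𝟙 _) T (𝟙 _) (by simp [hT]) (by simp)
  refine Limits.IsZero.of_iso ?_ (groupCohomologyIso A n P)
  rw [← HomologicalComplex.exactAt_iff_isZero_homology, HomologicalComplex.exactAt_iff,
    ShortComplex.moduleCat_exact_iff]
  intro (f : P.complex.X n ⟶ A) (hf : P.complex.d _ n ≫ f = 0)
  let f' := f ≫ inv (A.applyAsHom g - 𝟙 A)
  have hf' : P.complex.d ((ComplexShape.up ℕ).next n) n ≫ f' = 0 := by
    simp [f', reassoc_of% hf]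
  have key : f = P.complex.d n ((ComplexShape.up ℕ).prev n) ≫ s.hom _ n ≫ f' := by
    have hTf : T.f n ≫ f' = f + f' := by
      have hT_comm : T.f n ≫ f' = f' ≫ A.applyAsHom g := Rep.applyAsHom_comm f' g
      have hf_eq : f' ≫ (A.applyAsHom g - 𝟙 A) = f :=
        (Category.assoc _ _ _).trans (by rw [IsIso.inv_hom_id, Category.comp_id])
      rw [hT_comm, ← hf_eq, Preadditive.comp_sub, Category.comp_id, sub_add_cancel]
    have hd : dNext n s.hom =
        P.complex.d n ((ComplexShape.up ℕ).prev n) ≫ s.hom _ n := rfl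
    have hp : prevD n s.hom =
        s.hom n _ ≫ P.complex.d ((ComplexShape.up ℕ).next n) n := rfl
    rw [s.comm n, hd, hp] at hTf
    simp only [Preadditive.add_comp, Category.assoc, hf', Limits.comp_zero, add_zero,
      HomologicalComplex.id_f, Category.id_comp] at hTf
    exact (add_right_cancel hTf).symm
  exact ⟨s.hom _ n ≫ f', key.symm⟩

/-- If `Γ` is a finitely generated free abelian group and `α : Γ → ℂ*` is a
non-trivial character, then the group cohomology `H^n(Γ, ℂ_α)` vanishes for all `n`. -/
theorem stmt0 (Γ : Type) [AddCommGroup Γ] [Module.Free ℤ Γ] [Module.Finite ℤ Γ]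
    (α : Multiplicative Γ →* ℂˣ) (hα : α ≠ 1) (n : ℕ) :
    Limits.IsZero (groupCohomology (charRep (Multiplicative Γ) α) n) := by
  obtain ⟨g, hg⟩ : ∃ g, α g ≠ 1 := by
    by_contra! h
    exact hα (MonoidHom.ext h)
  have hc : (α g : ℂ) - 1 ≠ 0 := sub_ne_zero.2 (by simpa using hg)
  let A := charRep (Multiplicative Γ) α
  have h : A.applyAsHom g - 𝟙 A = ((α g : ℂ) - 1) • 𝟙 A := by
    rw [sub_smul, one_smul]
    rfl
  have : IsIso (A.applyAsHom g - 𝟙 A) := by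
    rw [h]
    exact ⟨((α g : ℂ) - 1)⁻¹ • 𝟙 A, by simp [smul_smul, hc], by simp [smul_smul, hc]⟩
  exact groupCohomology.isZero_of_isIso_applyAsHom_sub_id A g n
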